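/- Let ω₁, ω₂ be nonzero complex numbers with Im(ω₂/ω₁) > 0, let ℘̃ = ℘̃_{ω₁,ω₂} be the translated Weierstrass function with poles on ω₀ + Λ (ω₀ = (ω₁+ω₂)/2, Λ = ω₁ℤ + ω₂ℤ), and let ν₀, ν₂ be defined by the Laurent expansion ℘̃(z+ω₀) = 1/z² + ν₀ + ν₂ z² + O(z⁴) at z = 0. Then ℘̃ satisfies the differential equation (℘̃')² = 4℘̃³ + a℘̃² + b℘̃ on ℂ \ (ω₀ + Λ), where a = −12ν₀ and b = 12ν₀² − 20ν₂. -/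

import Mathlib

open Asymptotics
open scoped Topology

/-- The Weierstrass ℘-function of the lattice `ω₁ℤ + ω₂ℤ`. -/
noncomputable def wp (ω₁ ω₂ : ℂ) (z : ℂ) : ℂ :=
  1 / z ^ 2 + ∑' p : ℤ × ℤ,
    if p = 0 then 0 else
      (1 / (z + (p.1 : ℂ) * ω₁ + (p.2 : ℂ) * ω₂) ^ 2
        - 1 / ((p.1 : ℂ) * ω₁ + (p.2 : ℂ) * ω₂) ^ 2)

/-- The translated Weierstrass function `℘̃(z) = ℘(z + ω₀) − ℘(ω₀)`, `ω₀ = (ω₁+ω₂)/2`. -/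
noncomputable def wpTilde (ω₁ ω₂ : ℂ) (z : ℂ) : ℂ :=
  wp ω₁ ω₂ (z + (ω₁ + ω₂) / 2) - wp ω₁ ω₂ ((ω₁ + ω₂) / 2)

/-- Complex numbers whose quotient is not real are linearly independent over `ℝ`. -/
theorem linearIndependent_pair_of_im_div_ne_zero {ω₁ ω₂ : ℂ} (him : (ω₂ / ω₁).im ≠ 0) :
    LinearIndependent ℝ ![ω₁, ω₂] := by
  have h1 : ω₁ ≠ 0 := by
    rintro rfl
    simp at him
  rw [LinearIndependent.pair_iff]
  intro s t h
  have h' : (s : ℂ) + t * (ω₂ / ω₁) = 0 := by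
    simp only [Complex.real_smul] at h
    field_simp
    linear_combination h
  have ht : t = 0 := by
    simpa [him] using congrArg Complex.im h'
  subst ht
  simpa using h'

/-- `wp` agrees with Mathlib's Weierstrass function of the period pair. -/
theorem wp_eq_weierstrassP (L : PeriodPair) : wp L.ω₁ L.ω₂ = L.weierstrassP := by
  funext z
  rw [← L.weierstrassP_neg, ← L.weierstrassPExcept_add 0, PeriodPair.weierstrassPExcept,
    ← L.latticeEquivProd.symm.toEquiv.tsum_eq, wp, add_comm]
  congr 1
  · refine tsum_congr fun p => ?_
    have hp : (p.1 * L.ω₁ + p.2 * L.ω₂ : ℂ) = ((0 : L.lattice) : ℂ) ↔ p = 0 := by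
      rw [← L.latticeEquiv_symm_apply, Subtype.coe_inj, LinearEquiv.map_eq_zero_iff]
    simp only [LinearEquiv.coe_toEquiv, L.latticeEquiv_symm_apply, hp]
    congr 3
    ring
  · simp

/-- If `A + B z²` is `O(z³)` near zero then both coefficients vanish. -/
theorem eq_zero_of_add_mul_sq_isBigO_cube {A B : ℂ}
    (h : (fun z : ℂ => A + B * z ^ 2) =O[𝓝[≠] (0 : ℂ)] fun z => z ^ 3) : A = 0 ∧ B = 0 := by
  have hlim (n : ℕ) : Filter.Tendsto (fun z : ℂ => z ^ (n + 1)) (𝓝[≠] 0) (𝓝 0) := by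
    have : ContinuousAt (fun z : ℂ => z ^ (n + 1)) 0 := by fun_prop
    simpa [ContinuousAt] using this.tendsto.mono_left nhdsWithin_le_nhds
  have hA : A = 0 := by
    refine tendsto_nhds_unique ?_ (h.trans_tendsto (hlim 2))
    simpa using tendsto_const_nhds.add ((hlim 1).const_mul B)
  subst hA
  refine ⟨rfl, ?_⟩
  have hB : (fun _ : ℂ => B) =O[𝓝[≠] (0 : ℂ)] fun z => z ^ 1 := by
    refine (h.mul (isBigO_refl (fun z : ℂ => (z ^ 2)⁻¹) _)).congr' ?_ ?_ <;>
    · filter_upwards [self_mem_nhdsWithin] with z hz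
      have hz : z ≠ 0 := hz
      field_simp
      try ring
  exact tendsto_nhds_unique tendsto_const_nhds (hB.trans_tendsto (hlim 0))

namespace PeriodPair

variable (L : PeriodPair)

/-- The regular part of the Weierstrass function at zero is `3 G₄ z² + O(z³)`. -/
theorem weierstrassP_sub_isBigO_cube :
    (fun z : ℂ => L.weierstrassP z - 1 / z ^ 2 - 3 * L.G 4 * z ^ 2)
      =O[𝓝[≠] (0 : ℂ)] fun z => z ^ 3 := by
  have h := ((L.hasFPowerSeriesAt_weierstrassPExcept 0).isBigO_sub_partialSum_pow 3).mono
    (nhdsWithin_le_nhds (s := {0}ᶜ))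
  simp_rw [← norm_pow] at h
  refine h.of_norm_right.congr_left fun z => ?_
  have hz := L.weierstrassPExcept_def 0 z
  simp only [ZeroMemClass.coe_zero] at hz
  simp [FormalMultilinearSeries.partialSum, Finset.sum_range_succ, hz,
    L.G_eq_zero_of_odd 3 (by decide)]
  ring

theorem half_period_notMem_lattice : (L.ω₁ + L.ω₂) / 2 ∉ L.lattice := by
  have h := (L.mul_ω₁_add_mul_ω₂_mem_lattice (α := 1 / 2) (β := 1 / 2)).not.mpr (by norm_num)
  convert h using 1
  push_cast
  ring_nf

/-- The derivative of the Weierstrass function vanishes at a half period. -/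
theorem derivWeierstrassP_half_period : L.derivWeierstrassP ((L.ω₁ + L.ω₂) / 2) = 0 := by
  have h := L.derivWeierstrassP_sub_coe ((L.ω₁ + L.ω₂) / 2)
    ⟨_, add_mem L.ω₁_mem_lattice L.ω₂_mem_lattice⟩
  rw [show (L.ω₁ + L.ω₂) / 2 - (L.ω₁ + L.ω₂) = -((L.ω₁ + L.ω₂) / 2) by ring,
    L.derivWeierstrassP_neg] at h
  exact CharZero.eq_neg_self_iff.mp h.symm

end PeriodPair

theorem stmt16 (ω₁ ω₂ : ℂ) (h1 : ω₁ ≠ 0) (h2 : ω₂ ≠ 0) (him : 0 < (ω₂ / ω₁).im)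
    (ν₀ ν₂ : ℂ)
    -- the Laurent expansion `℘̃(z+ω₀) = 1/z² + ν₀ + ν₂z² + O(z⁴)` at `z = 0`
    (hlaurent :
      (fun z : ℂ => wpTilde ω₁ ω₂ (z + (ω₁ + ω₂) / 2) - 1 / z ^ 2 - ν₀ - ν₂ * z ^ 2)
        =O[𝓝[≠] (0 : ℂ)] fun z => z ^ 4) :
    ∀ z : ℂ, (∀ n m : ℤ, z ≠ (ω₁ + ω₂) / 2 + (n : ℂ) * ω₁ + (m : ℂ) * ω₂) →
      (deriv (wpTilde ω₁ ω₂) z) ^ 2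
        = 4 * (wpTilde ω₁ ω₂ z) ^ 3 + (-12 * ν₀) * (wpTilde ω₁ ω₂ z) ^ 2
          + (12 * ν₀ ^ 2 - 20 * ν₂) * (wpTilde ω₁ ω₂ z) := by
  obtain ⟨L, rfl, rfl⟩ : ∃ L : PeriodPair, L.ω₁ = ω₁ ∧ L.ω₂ = ω₂ :=
    ⟨⟨ω₁, ω₂, linearIndependent_pair_of_im_div_ne_zero him.ne'⟩, rfl, rfl⟩
  set ω₀ := (L.ω₁ + L.ω₂) / 2 with hω₀
  have htilde : wpTilde L.ω₁ L.ω₂ = fun z => L.weierstrassP (z + ω₀) - L.weierstrassP ω₀ := by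
    funext z
    rw [wpTilde, wp_eq_weierstrassP]
  have hperiod (z : ℂ) : L.weierstrassP (z + ω₀ + ω₀) = L.weierstrassP z := by
    have h := L.weierstrassP_add_coe z ⟨_, add_mem L.ω₁_mem_lattice L.ω₂_mem_lattice⟩
    rw [← h, hω₀]
    congr 1
    ring
  obtain ⟨hν₀, hν₂⟩ : -L.weierstrassP ω₀ - ν₀ = 0 ∧ 3 * L.G 4 - ν₂ = 0 := by
    apply eq_zero_of_add_mul_sq_isBigO_cube
    have hpow : (fun z : ℂ => z ^ 4) =O[𝓝[≠] (0 : ℂ)] fun z => z ^ 3 :=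
      (isLittleO_pow_pow (by norm_num : 3 < 4)).isBigO.mono nhdsWithin_le_nhds
    refine ((hlaurent.trans hpow).sub L.weierstrassP_sub_isBigO_cube).congr_left fun z => ?_
    simp only [htilde, hperiod]
    ring
  intro z hz
  have hzL : z + ω₀ ∉ L.lattice := by
    intro h
    obtain ⟨m, n, e⟩ := PeriodPair.mem_lattice.mp h
    apply hz (m - 1) (n - 1)
    push_cast
    linear_combination -e - 2 * hω₀
  have hderiv : deriv (wpTilde L.ω₁ L.ω₂) z = L.derivWeierstrassP (z + ω₀) := by
    rw [htilde, deriv_sub_const, deriv_comp_add_const, L.deriv_weierstrassP]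
  have hode := L.derivWeierstrassP_sq _ hzL
  have hconst := L.derivWeierstrassP_sq _ L.half_period_notMem_lattice
  rw [L.derivWeierstrassP_half_period, ← hω₀] at hconst
  rw [hderiv, hode, htilde, PeriodPair.g₂]
  rw [PeriodPair.g₂] at hconst
  obtain rfl : ν₀ = -L.weierstrassP ω₀ := by linear_combination -hν₀
  obtain rfl : ν₂ = 3 * L.G 4 := by linear_combination -hν₂
  linear_combination -hconst
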